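/- There exists an absolute constant H₀ such that the following holds. Let H ≥ H₀ be a real number, let f ∈ ℤ[x₀,x₁,x₂] be a primitive irreducible homogeneous polynomial of degree d with (log H)² < d < H^{3/2}, and let C ⊆ ℙ²_ℚ be the plane curve it defines. Let p be a prime number with p > log H, let f̄ ∈ 𝔽_p[x₀,x₁,x₂] denote the reduction of f modulo p (which is nonzero since f is primitive), and let P ∈ ℙ²(𝔽_p) be a point with mult_P(f̄) < d/(log H). Then there exists a nonzero homogeneous polynomial g ∈ ℚ[x₀,x₁,x₂] of degree d−1 vanishing at every point of C(ℚ,H) whose reduction modulo p equals P. -/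

import Mathlib

open MvPolynomial

/-- The multiplicity of a polynomial `g` at a point `q`: the smallest total
degree of a monomial occurring with nonzero coefficient in the translate
`g(q + y)`. -/
noncomputable def multAt {F : Type*} [CommRing F] {m : ℕ} (q : Fin m → F)
    (g : MvPolynomial (Fin m) F) : ℕ :=
  sInf {k : ℕ | ∃ s ∈ (MvPolynomial.aeval
      (fun i => MvPolynomial.C (q i) + MvPolynomial.X i) g).support,
    (s.sum fun _ e => e) = k}

theorem card_le_of_not_le (α : Fin 2 →₀ ℕ) (k : ℕ) (S : Finset (Fin 2 →₀ ℕ))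
    (hS : ∀ β ∈ S, ¬ α ≤ β ∧ β 0 + β 1 ≤ k) : S.card ≤ (α 0 + α 1) * (k + 1) := by
  have h := Finset.card_le_card_of_injOn (s := S)
    (t := Finset.range (α 0 + α 1) ×ˢ Finset.range (k + 1))
    (fun β => (if β 0 < α 0 then β 0 else α 0 + β 1, β 0 + β 1)) ?_ ?_
  · simpa using h
  · intro β hβ
    obtain ⟨h1, h2⟩ := hS β hβ
    simp only [Finsupp.le_def, Fin.forall_fin_two] at h1
    simp only [Finset.coe_product, Finset.coe_range, Set.mem_prod, Set.mem_Iio]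
    constructor
    · split_ifs <;> omega
    · omega
  · intro β _ γ _ h
    simp only [Prod.mk.injEq] at h
    ext i
    obtain ⟨h1, h2⟩ := h
    have : β 0 = γ 0 ∧ β 1 = γ 1 := by
      split_ifs at h1 <;> omega
    fin_cases i
    · exact this.1
    · exact this.2

theorem card_mul_le_sum_weights {ι : Type*} [Fintype ι] (w : ι → ℕ) (μ t : ℕ)
    (hw : ∀ k, (Finset.univ.filter fun i => w i ≤ k).card ≤ μ * (k + 1))
    (hμ : μ * (2 * t + 1) ≤ Fintype.card ι) :
    Fintype.card ι * t ≤ ∑ i, w i := by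
  have h1 : ∀ i, 2 * t ≤ w i + ∑ k ∈ Finset.range (2 * t), if w i ≤ k then 1 else 0 := by
    intro i
    have h : ∀ n : ℕ, n ≤ w i + ∑ k ∈ Finset.range n, if w i ≤ k then 1 else 0 := by
      intro n
      induction n with
      | zero => simp
      | succ n ih =>
        rw [Finset.sum_range_succ]
        split_ifs <;> omega
    exact h _
  have h2 : Fintype.card ι * (2 * t) ≤
      ∑ i, w i + ∑ k ∈ Finset.range (2 * t), μ * (k + 1) := by
    calc Fintype.card ι * (2 * t) = ∑ _i : ι, 2 * t := by simp
      _ ≤ ∑ i, (w i + ∑ k ∈ Finset.range (2 * t), if w i ≤ k then 1 else 0) :=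
        Finset.sum_le_sum fun i _ => h1 i
      _ = ∑ i, w i + ∑ k ∈ Finset.range (2 * t), ∑ i, if w i ≤ k then 1 else 0 := by
        rw [Finset.sum_add_distrib, Finset.sum_comm (s := Finset.univ)]
      _ ≤ _ := by
        gcongr with k
        simpa using hw k
  have h3 : ∀ n : ℕ, 2 * ∑ k ∈ Finset.range n, μ * (k + 1) = μ * (n * (n + 1)) := by
    intro n
    induction n with
    | zero => simp
    | succ n ih => rw [Finset.sum_range_succ, mul_add, ih]; ring
  have h4 := h3 (2 * t)
  nlinarith

theorem det_eq_zero_of_mem_span {R ι B : Type*} [CommRing R] [Fintype ι] [DecidableEq ι]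
    (π : R) (w : B → ι → R) (deg : B → ℕ) (v : ι → ι → R)
    (hv : ∀ i, v i ∈ Submodule.span R (Set.range fun b => π ^ deg b • w b))
    (hdeg : ∀ r : ι → B, Function.Injective r → π ^ ∑ i, deg (r i) = 0) :
    Matrix.det (Matrix.of v) = 0 := by
  classical
  simp only [Finsupp.mem_span_range_iff_exists_finsupp] at hv
  choose c hc using hv
  have hv' : v = fun i => ∑ b ∈ (c i).support, c i b • π ^ deg b • w b := by
    funext i
    exact (hc i).symm
  change Matrix.detRowAlternating v = 0
  rw [hv', ← AlternatingMap.coe_multilinearMap, MultilinearMap.map_sum_finset]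
  refine Finset.sum_eq_zero fun r _ => ?_
  rw [AlternatingMap.coe_multilinearMap, AlternatingMap.map_smul_univ,
    AlternatingMap.map_smul_univ]
  by_cases hr : Function.Injective r
  · rw [Finset.prod_pow_eq_pow_sum, hdeg r hr, zero_smul, smul_zero]
  · simp only [Function.Injective, not_forall] at hr
    obtain ⟨i, j, hij, hne⟩ := hr
    rw [AlternatingMap.map_eq_zero_of_eq _ _ (by rw [hij]) hne, smul_zero, smul_zero]

/-- Modulo a relation with leading exponent `α`, monomials in nilpotent quantities `z = π • w` are
combinations of the monomials not divisible by the leading one. -/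
theorem aeval_monomial_mem_span {R A : Type*} [CommRing R] [CommRing A] [Algebra R A]
    (π : R) (e : ℕ) (hπ : π ^ e = 0) (z : Fin 2 → A) (w : Fin 2 → A)
    (hz : ∀ i, z i = π • w i) (h : MvPolynomial (Fin 2) R) (hh : aeval z h = 0)
    (α : Fin 2 →₀ ℕ) (hα : IsUnit (h.coeff α))
    (hlow : ∀ γ : Fin 2 →₀ ℕ, γ 0 + γ 1 < α 0 + α 1 → π ∣ h.coeff γ)
    (hlead : ∀ γ : Fin 2 →₀ ℕ, γ 0 + γ 1 = α 0 + α 1 → α 0 < γ 0 → π ∣ h.coeff γ)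
    (β : Fin 2 →₀ ℕ) :
    aeval z (monomial β (1 : R)) ∈ Submodule.span R
      (Set.range fun b : {b : Fin 2 →₀ ℕ // ¬ α ≤ b} =>
        π ^ (b.1 0 + b.1 1) • aeval w (monomial b.1 (1 : R))) := by
  set T := Submodule.span R
      (Set.range fun b : {b : Fin 2 →₀ ℕ // ¬ α ≤ b} =>
        π ^ (b.1 0 + b.1 1) • aeval w (monomial b.1 (1 : R)))
  have hm : ∀ β : Fin 2 →₀ ℕ, aeval z (monomial β (1 : R)) =
      π ^ (β 0 + β 1) • aeval w (monomial β (1 : R)) := by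
    intro β
    rw [aeval_monomial, aeval_monomial, Finsupp.prod_fintype _ _ (fun _ => pow_zero _),
      Finsupp.prod_fintype _ _ (fun _ => pow_zero _)]
    simp only [Fin.prod_univ_two, hz, smul_pow, map_one, one_mul, pow_add, smul_mul_smul_comm]
  have hstd : ∀ β : Fin 2 →₀ ℕ, ¬ α ≤ β → aeval z (monomial β (1 : R)) ∈ T := by
    intro β hβ
    rw [hm]
    exact Submodule.subset_span ⟨⟨β, hβ⟩, rfl⟩
  obtain ⟨u, hu⟩ := hα
  -- the relation, multiplied by a monomial and solved for its distinguished term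
  have hrel : ∀ δ : Fin 2 →₀ ℕ, aeval z (monomial (α + δ) (1 : R)) =
      - ∑ γ ∈ h.support.erase α,
        ((↑u⁻¹ : R) * h.coeff γ) • aeval z (monomial (γ + δ) (1 : R)) := by
    intro δ
    have h0 : ∑ γ ∈ h.support, h.coeff γ • aeval z (monomial (γ + δ) (1 : R)) = 0 := by
      have := congrArg (· * aeval z (monomial δ (1 : R))) hh
      simp only [zero_mul] at this
      rw [← this]
      conv_rhs => rw [h.as_sum, map_sum, Finset.sum_mul]
      refine Finset.sum_congr rfl fun γ _ => ?_
      rw [← map_mul, monomial_mul, mul_one, ← map_smul, smul_monomial, smul_eq_mul, mul_one]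
    by_cases hR : Nontrivial R
    swap
    · rw [not_nontrivial_iff_subsingleton] at hR
      have : Subsingleton A := Module.subsingleton R A
      exact Subsingleton.elim _ _
    have hmem : α ∈ h.support := by
      rw [mem_support_iff, ← hu]
      exact u.ne_zero
    rw [← Finset.add_sum_erase _ _ hmem, ← hu] at h0
    simp only [mul_smul, ← Finset.smul_sum]
    rw [← smul_neg, ← eq_neg_of_add_eq_zero_left h0, ← mul_smul, Units.inv_mul, one_smul]
  have main : ∀ n k, e ≤ k + n → ∀ β : Fin 2 →₀ ℕ,
      π ^ k • aeval z (monomial β (1 : R)) ∈ T := by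
    intro n
    induction n with
    | zero =>
      intro k hk β
      rw [pow_eq_zero_of_le (by omega : e ≤ k) hπ, zero_smul]
      exact T.zero_mem
    | succ n ihn =>
      intro k hk
      have ihk := ihn (k + 1) (by omega)
      have : ∀ m, ∀ β : Fin 2 →₀ ℕ, e ≤ β 0 + β 1 + m →
          π ^ k • aeval z (monomial β (1 : R)) ∈ T := by
        intro m
        induction m with
        | zero =>
          intro β hβ
          rw [hm, pow_eq_zero_of_le (by omega : e ≤ β 0 + β 1) hπ, zero_smul, smul_zero]
          exact T.zero_mem
        | succ m ihm =>
          have : ∀ a, ∀ β : Fin 2 →₀ ℕ, β 0 = a → e ≤ β 0 + β 1 + (m + 1) →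
              π ^ k • aeval z (monomial β (1 : R)) ∈ T := by
            intro a
            induction a using Nat.strong_induction_on with
            | _ a iha =>
              intro β hβa hβ
              by_cases hle : α ≤ β
              swap
              · exact T.smul_mem _ (hstd β hle)
              obtain ⟨δ, rfl⟩ := exists_add_of_le hle
              rw [hrel, smul_neg, Finset.smul_sum]
              refine T.neg_mem (T.sum_mem fun γ hγ => ?_)
              have hne : γ ≠ α := Finset.ne_of_mem_erase hγ
              rw [smul_comm, mul_smul]
              simp only [Finsupp.add_apply] at hβ hβa
              have hdvd : π ∣ h.coeff γ → (↑u⁻¹ : R) • h.coeff γ •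
                  π ^ k • aeval z (monomial (γ + δ) (1 : R)) ∈ T := by
                rintro ⟨c, hc⟩
                rw [hc, mul_comm π c, mul_smul c π, ← mul_smul π, ← pow_succ']
                exact T.smul_mem _ (T.smul_mem _ (ihk _))
              rcases lt_trichotomy (γ 0 + γ 1) (α 0 + α 1) with hlt | heq | hgt
              · exact hdvd (hlow γ hlt)
              · rcases lt_trichotomy (γ 0) (α 0) with hlt' | heq' | hgt'
                · refine T.smul_mem _ (T.smul_mem _ (iha _ ?_ _ rfl ?_)) <;>
                    simp only [Finsupp.add_apply] <;> omega
                · exfalso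
                  apply hne
                  ext i
                  fin_cases i
                  · exact heq'
                  · change γ 1 = α 1
                    omega
                · exact hdvd (hlead γ heq hgt')
              · refine T.smul_mem _ (T.smul_mem _ (ihm _ ?_))
                simp only [Finsupp.add_apply]
                omega
          exact fun β hβ => this _ β rfl hβ
      exact fun β => this e β (by omega)
  simpa using main e 0 (by omega) β

theorem aeval_mul_of_isHomogeneous {σ R A : Type*} [CommRing R] [CommRing A] [Algebra R A]
    {f : MvPolynomial σ R} {d : ℕ} (hf : f.IsHomogeneous d) (v : A) (y : σ → A) :
    aeval (fun i => v * y i) f = v ^ d * aeval y f := by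
  rw [f.as_sum, map_sum, map_sum, Finset.mul_sum]
  refine Finset.sum_congr rfl fun s hs => ?_
  have hd : s.degree = d := by
    rw [← hf (mem_support_iff.1 hs), Finsupp.degree_eq_weight_one]
    rfl
  rw [aeval_monomial, aeval_monomial, ← hd, Finsupp.degree_apply, Finsupp.prod, Finsupp.prod]
  simp only [mul_pow, Finset.prod_mul_distrib, Finset.prod_pow_eq_pow_sum]
  ring

/-- The multiplicity of a homogeneous polynomial at a point with `q j ≠ 0` does not increase when
the translate is restricted to the hyperplane where the `j`-th coordinate of the increment is `0`. -/
theorem exists_coeff_restrict_ne_zero {F : Type*} [Field F] {f : MvPolynomial (Fin 3) F} {d : ℕ}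
    (hf : f.IsHomogeneous d) (q : Fin 3 → F) (j : Fin 3) (hq : q j ≠ 0) (m : ℕ)
    (hm : ∃ s : Fin 3 →₀ ℕ, s.degree ≤ m ∧ coeff s (aeval (fun i => C (q i) + X i) f :
      MvPolynomial (Fin 3) F) ≠ 0) :
    ∃ γ : Fin 2 →₀ ℕ, γ.degree ≤ m ∧ coeff γ (aeval (fun i => C (q i) +
      (j.insertNth 0 X : Fin 3 → MvPolynomial (Fin 2) F) i) f : MvPolynomial (Fin 2) F) ≠ 0 := by
  by_contra! hcon
  set h : MvPolynomial (Fin 2) F := aeval (fun i => C (q i) +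
      (j.insertNth 0 X : Fin 3 → MvPolynomial (Fin 2) F) i) f with hh
  have hmem : h ∈ idealOfVars (Fin 2) F ^ (m + 1) := by
    rw [mem_pow_idealOfVars_iff']
    intro γ hγ
    exact hcon γ (by omega)
  obtain ⟨s, hs, hs0⟩ := hm
  set I := idealOfVars (Fin 3) F with hI
  let A := MvPolynomial (Fin 3) F ⧸ I ^ (m + 1)
  let φ : MvPolynomial (Fin 3) F →ₐ[F] A := Ideal.Quotient.mkₐ F (I ^ (m + 1))
  have hIX : ∀ i, (X i : MvPolynomial (Fin 3) F) ∈ I := fun i => Ideal.subset_span ⟨i, rfl⟩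
  have hJ : (I.map φ.toRingHom) ^ (m + 1) = ⊥ := by
    rw [← Ideal.map_pow]
    exact Ideal.map_quotient_self _
  have hζ : ∀ i, φ (X i) ∈ I.map φ.toRingHom := fun i => Ideal.mem_map_of_mem φ.toRingHom (hIX i)
  set t : A := algebraMap F A (q j)⁻¹ * φ (X j) with ht
  have htJ : t ∈ I.map φ.toRingHom := Ideal.mul_mem_left _ _ (hζ j)
  have htn : IsNilpotent t := ⟨m + 1, by
    have := Ideal.pow_mem_pow htJ (m + 1)
    rwa [hJ, Ideal.mem_bot] at this⟩
  obtain ⟨u, hu⟩ := htn.isUnit_one_add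
  let w : Fin 3 → A := fun i => (↑u⁻¹ : A) * (φ (X i) - t * algebraMap F A (q i))
  have hwj : w j = 0 := by
    have : t * algebraMap F A (q j) = φ (X j) := by
      rw [ht, mul_right_comm, ← map_mul, inv_mul_cancel₀ hq, map_one, one_mul]
    simp only [w, this, sub_self, mul_zero]
  have hw : ∀ i, (↑u⁻¹ : A) * (algebraMap F A (q i) + φ (X i)) = algebraMap F A (q i) + w i := by
    intro i
    have h1 : algebraMap F A (q i) + φ (X i) =
        ↑u * algebraMap F A (q i) + (φ (X i) - t * algebraMap F A (q i)) := by
      rw [hu]; ring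
    rw [h1, mul_add, ← mul_assoc, Units.inv_mul, one_mul]
  have hwJ : ∀ i, w i ∈ I.map φ.toRingHom := fun i =>
    Ideal.mul_mem_left _ _ (sub_mem (hζ i) (Ideal.mul_mem_right _ _ htJ))
  let ψ : MvPolynomial (Fin 2) F →ₐ[F] A := aeval fun k => w (j.succAbove k)
  have hψ : ψ h = 0 := by
    have h1 : (idealOfVars (Fin 2) F).map ψ.toRingHom ≤ I.map φ.toRingHom := by
      rw [Ideal.map_le_iff_le_comap, idealOfVars, Ideal.span_le]
      rintro _ ⟨k, rfl⟩
      change ψ (X k) ∈ I.map φ.toRingHom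
      simp only [ψ, aeval_X]
      exact hwJ _
    have h2 := Ideal.pow_right_mono h1 (m + 1)
    rw [hJ, ← Ideal.map_pow] at h2
    exact h2 (Ideal.mem_map_of_mem ψ.toRingHom hmem)
  have hψ' : ψ h = aeval (fun i => algebraMap F A (q i) + w i) f := by
    rw [hh, ← AlgHom.comp_apply, comp_aeval]
    congr 2
    funext i
    rw [map_add]
    congr 1
    · exact ψ.commutes _
    · refine Fin.succAboveCases j ?_ (fun k => ?_) i
      · simp [hwj]
      · simp [ψ]
  have hg : φ (aeval (fun i => C (q i) + X i) f) = 0 := by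
    rw [← AlgHom.comp_apply, comp_aeval]
    have : (fun i => φ (C (q i) + X i)) =
        fun i => (u : A) * (algebraMap F A (q i) + w i) := by
      funext i
      rw [← hw, Units.mul_inv_cancel_left, map_add]
      congr 1
    rw [this, aeval_mul_of_isHomogeneous hf, ← hψ', hψ, mul_zero]
  have hg' : (aeval (fun i => C (q i) + X i) f : MvPolynomial (Fin 3) F) ∈ I ^ (m + 1) :=
    Ideal.Quotient.eq_zero_iff_mem.1 hg
  rw [mem_pow_idealOfVars_iff'] at hg'
  exact hs0 (hg' s (by omega))

theorem exists_coeff_degree_eq_multAt {F : Type*} [CommRing F] {m : ℕ} (q : Fin m → F)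
    {g : MvPolynomial (Fin m) F} (hg : g ≠ 0) :
    ∃ s : Fin m →₀ ℕ, s.degree = multAt q g ∧
      coeff s (aeval (fun i => C (q i) + X i) g : MvPolynomial (Fin m) F) ≠ 0 := by
  set G : MvPolynomial (Fin m) F := aeval (fun i => C (q i) + X i) g with hG
  have hG0 : G ≠ 0 := by
    intro h0
    apply hg
    have h1 : aeval (fun i => X i - C (q i) : Fin m → MvPolynomial (Fin m) F) G = g := by
      rw [hG, ← AlgHom.comp_apply, comp_aeval]
      simp [← algebraMap_eq]
    rw [← h1, h0, map_zero]
  obtain ⟨s, hs⟩ := support_nonempty.2 hG0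
  obtain ⟨s', hs', hdeg⟩ := Nat.sInf_mem (⟨_, s, hs, rfl⟩ : {k : ℕ | ∃ s ∈ G.support,
    (s.sum fun _ e => e) = k}.Nonempty)
  exact ⟨s', hdeg, mem_support_iff.1 hs'⟩

theorem degree_fin_two (γ : Fin 2 →₀ ℕ) : γ.degree = γ 0 + γ 1 := by
  rw [Finsupp.degree_eq_sum, Fin.sum_univ_two]

theorem exists_leading_exponent {F : Type*} [CommRing F] {h : MvPolynomial (Fin 2) F} (m : ℕ)
    (hm : ∃ γ : Fin 2 →₀ ℕ, γ.degree ≤ m ∧ coeff γ h ≠ 0) :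
    ∃ α : Fin 2 →₀ ℕ, α 0 + α 1 ≤ m ∧ coeff α h ≠ 0 ∧
      (∀ γ : Fin 2 →₀ ℕ, γ 0 + γ 1 < α 0 + α 1 → coeff γ h = 0) ∧
      ∀ γ : Fin 2 →₀ ℕ, γ 0 + γ 1 = α 0 + α 1 → α 0 < γ 0 → coeff γ h = 0 := by
  obtain ⟨γ₀, hγ₀, hc⟩ := hm
  rw [degree_fin_two] at hγ₀
  obtain ⟨γ₁, h1, hmin⟩ := Finset.exists_min_image h.support (fun γ => γ 0 + γ 1)
    ⟨γ₀, mem_support_iff.2 hc⟩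
  obtain ⟨α, hα, hmax⟩ := Finset.exists_max_image
    (h.support.filter fun γ => γ 0 + γ 1 = γ₁ 0 + γ₁ 1) (fun γ => γ 0) ⟨γ₁, by simpa using h1⟩
  rw [Finset.mem_filter] at hα
  have hle := hmin γ₀ (mem_support_iff.2 hc)
  refine ⟨α, by omega, mem_support_iff.1 hα.1, fun γ hγ => ?_, fun γ hγ hlt => ?_⟩
  · by_contra hne
    have := hmin γ (mem_support_iff.2 hne)
    omega
  · by_contra hne
    have := hmax γ (Finset.mem_filter.2 ⟨mem_support_iff.2 hne, by omega⟩)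
    omega

/-- The determinant of monomials evaluated at points of a plane curve with the same reduction `q`
vanishes modulo a power of `π` controlled by the multiplicity at `q`. -/
theorem det_eval_monomial_eq_zero {R F ι : Type*} [CommRing R] [Field F] [Fintype ι]
    [DecidableEq ι] (ρ : R →+* F) (hρ : Function.Surjective ρ) (π : R)
    (hker : ∀ a, ρ a = 0 → π ∣ a) (hunit : ∀ a, ρ a ≠ 0 → IsUnit a)
    (t : ℕ) (hπ : π ^ (Fintype.card ι * t) = 0) {f : MvPolynomial (Fin 3) R} {d : ℕ}
    (hf : f.IsHomogeneous d) (hne : map ρ f ≠ 0) (q : Fin 3 → F) (hq : q ≠ 0)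
    (hμ : multAt q (map ρ f) * (2 * t + 1) ≤ Fintype.card ι) (x : ι → Fin 3 → R)
    (hx : ∀ i, ∃ a, a ≠ 0 ∧ ∀ k, ρ (x i k) = a * q k) (hfx : ∀ i, aeval (x i) f = 0)
    (D : ℕ) (s : ι → Fin 3 →₀ ℕ) (hs : ∀ i, (s i).degree = D) :
    Matrix.det (Matrix.of fun a i => aeval (x i) (monomial (s a) (1 : R))) = 0 := by
  obtain ⟨j, hj⟩ : ∃ j, q j ≠ 0 := by
    by_contra! h
    exact hq (funext h)
  obtain ⟨s₀, hs₀, hc₀⟩ := exists_coeff_degree_eq_multAt q hne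
  obtain ⟨α, hαm, hα, hlow, hlead⟩ := exists_leading_exponent _
    (exists_coeff_restrict_ne_zero (hf.map ρ) q j hj _ ⟨s₀, hs₀.le, hc₀⟩)
  choose l hl using hρ
  let res : MvPolynomial (Fin 3) R →ₐ[R] MvPolynomial (Fin 2) R :=
    aeval fun i => C (l (q i)) + (j.insertNth 0 X : Fin 3 → MvPolynomial (Fin 2) R) i
  have hres : (aeval (fun i => C (q i) + (j.insertNth 0 X : Fin 3 → MvPolynomial (Fin 2) F) i)
      (map ρ f) : MvPolynomial (Fin 2) F) = map ρ (res f) := by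
    simp only [res]
    rw [map_aeval, aeval_def, eval₂_map, coe_eval₂Hom]
    congr 1
    · ext a
      simp
    · funext i
      rw [map_add, map_C, hl]
      congr 1
      refine Fin.succAboveCases j ?_ (fun k => ?_) i <;> simp
  simp only [hres, coeff_map] at hα hlow hlead
  choose a ha hax using hx
  have hxj : ∀ i, IsUnit (x i j) := fun i => hunit _ (by
    rw [hax]; exact mul_ne_zero (ha i) hj)
  choose U hU using hxj
  let u : ι → R := fun i => l (q j) * ↑(U i)⁻¹
  have hu : ∀ i, IsUnit (u i) := fun i => (hunit _ (by rwa [hl])).mul (Units.isUnit _)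
  have huj : ∀ i, u i * x i j = l (q j) := by
    intro i
    simp only [u]
    rw [← hU, mul_assoc, Units.inv_mul, mul_one]
  have hρu : ∀ i, ρ (u i) * a i = 1 := by
    intro i
    have := congrArg ρ (huj i)
    rw [map_mul, hax, hl, ← mul_assoc] at this
    exact mul_right_cancel₀ hj (this.trans (one_mul _).symm)
  let z : Fin 2 → ι → R := fun k i => u i * x i (j.succAbove k) - l (q (j.succAbove k))
  have hz : ∀ k i, π ∣ z k i := by
    intro k i
    apply hker
    simp only [z]
    rw [map_sub, map_mul, hax, hl, ← mul_assoc, hρu, one_mul, sub_self]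
  choose w hw using hz
  have hzres : ∀ (P : MvPolynomial (Fin 3) R) (i : ι),
      aeval z (res P) i = aeval (fun k => u i * x i k) P := by
    intro P i
    change ((Pi.evalAlgHom R (fun _ : ι => R) i).comp ((aeval z).comp res)) P = _
    simp only [res]
    rw [comp_aeval, comp_aeval]
    congr 2
    funext k
    refine Fin.succAboveCases j ?_ (fun k => ?_) k
    · simp [huj]
    · simp [z]
  have hrel : aeval z (res f) = 0 := by
    funext i
    rw [hzres, aeval_mul_of_isHomogeneous hf, hfx, mul_zero]
    rfl
  have hspan := aeval_monomial_mem_span π _ hπ z w (fun k => funext fun i => hw k i) _ hrel α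
    (hunit _ hα) (fun γ h => hker _ (hlow γ h)) (fun γ h h' => hker _ (hlead γ h h'))
  have hdet := det_eq_zero_of_mem_span (ι := ι) π
    (fun b : {b : Fin 2 →₀ ℕ // ¬ α ≤ b} => aeval w (monomial b.1 (1 : R)))
    (fun b => b.1 0 + b.1 1) (fun c => aeval z (res (monomial (s c) 1))) ?_ ?_
  · have hmat : (Matrix.of fun c => aeval z (res (monomial (s c) 1))) =
        Matrix.of fun c i => u i ^ D *
          (Matrix.of fun a i => aeval (x i) (monomial (s a) (1 : R))) c i := by
      ext c i
      simp only [Matrix.of_apply]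
      rw [hzres, aeval_mul_of_isHomogeneous (isHomogeneous_monomial 1 (hs c))]
    rw [hmat, Matrix.det_mul_row] at hdet
    refine (IsUnit.mul_right_eq_zero ?_).1 hdet
    exact IsUnit.prod_iff.2 fun i _ => (hu i).pow D
  · intro c
    rw [(res (monomial (s c) 1)).as_sum, map_sum]
    refine Submodule.sum_mem _ fun γ _ => ?_
    rw [← mul_one (coeff γ _), ← smul_eq_mul, ← smul_monomial, map_smul]
    exact Submodule.smul_mem _ _ (hspan γ)
  · intro r hr
    refine pow_eq_zero_of_le (card_mul_le_sum_weights _ (α 0 + α 1) t (fun k => ?_) ?_) hπ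
    · rw [← Finset.card_image_of_injective _ (Subtype.val_injective.comp hr)]
      refine card_le_of_not_le α k _ fun β hβ => ?_
      obtain ⟨i, hi, rfl⟩ := Finset.mem_image.1 hβ
      exact ⟨(r i).2, (Finset.mem_filter.1 hi).2⟩
    · exact (Nat.mul_le_mul_right _ hαm).trans hμ

theorem pow_dvd_det_eval_monomial {ι : Type*} [Fintype ι] [DecidableEq ι] (p : ℕ)
    [Fact p.Prime] (t : ℕ) {f : MvPolynomial (Fin 3) ℤ} {d : ℕ} (hf : f.IsHomogeneous d)
    (hne : map (Int.castRingHom (ZMod p)) f ≠ 0) (q : Fin 3 → ZMod p) (hq : q ≠ 0)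
    (hμ : multAt q (map (Int.castRingHom (ZMod p)) f) * (2 * t + 1) ≤ Fintype.card ι)
    (x : ι → Fin 3 → ℤ) (hx : ∀ i, ∃ a : ZMod p, a ≠ 0 ∧ ∀ k, (x i k : ZMod p) = a * q k)
    (hfx : ∀ i, eval (x i) f = 0) (D : ℕ) (s : ι → Fin 3 →₀ ℕ) (hs : ∀ i, (s i).degree = D) :
    (p : ℤ) ^ (Fintype.card ι * t) ∣
      Matrix.det (Matrix.of fun a i => eval (x i) (monomial (s a) (1 : ℤ))) := by
  have hp : p.Prime := Fact.out
  set e := Fintype.card ι * t with he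
  rcases Nat.eq_zero_or_pos e with h0 | hpos
  · rw [h0, pow_zero]
    exact one_dvd _
  have : NeZero (p ^ e) := ⟨pow_ne_zero _ hp.ne_zero⟩
  let ρ : ZMod (p ^ e) →+* ZMod p := ZMod.castHom (dvd_pow_self p hpos.ne') (ZMod p)
  have hval : ∀ a : ZMod (p ^ e), ρ a = ((a.val : ℕ) : ZMod p) := by
    intro a
    conv_lhs => rw [← ZMod.natCast_zmod_val a]
    exact map_natCast ρ _
  have hcomp : ρ.comp (Int.castRingHom (ZMod (p ^ e))) = Int.castRingHom (ZMod p) :=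
    RingHom.ext_int _ _
  have hmap : map ρ (map (Int.castRingHom (ZMod (p ^ e))) f) =
      map (Int.castRingHom (ZMod p)) f := by
    rw [map_map, hcomp]
  have hcast : ∀ (i : ι) (P : MvPolynomial (Fin 3) ℤ),
      aeval (fun k => ((x i k : ℤ) : ZMod (p ^ e))) (map (Int.castRingHom (ZMod (p ^ e))) P) =
        ((eval (x i) P : ℤ) : ZMod (p ^ e)) := by
    intro i P
    rw [aeval_def, eval₂_map, Algebra.algebraMap_self, RingHom.id_comp]
    exact (map_eval₂Hom (RingHom.id ℤ) (x i) (Int.castRingHom (ZMod (p ^ e))) P).symm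
  have key := det_eval_monomial_eq_zero ρ (ZMod.castHom_surjective _) ((p : ℕ) : ZMod (p ^ e))
    ?_ ?_ t ?_ (hf.map (Int.castRingHom (ZMod (p ^ e)))) (by rwa [hmap]) q hq (by rwa [hmap])
    (fun i k => ((x i k : ℤ) : ZMod (p ^ e))) ?_ ?_ D s hs
  · have h1 : ((Matrix.det (Matrix.of fun a i => eval (x i) (monomial (s a) (1 : ℤ))) : ℤ) :
        ZMod (p ^ e)) = 0 := by
      rw [← key, ← eq_intCast (Int.castRingHom (ZMod (p ^ e))), RingHom.map_det]
      congr 1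
      ext a i
      have := hcast i (monomial (s a) 1)
      rw [map_monomial, map_one] at this
      simp only [RingHom.mapMatrix_apply, Matrix.map_apply, Matrix.of_apply]
      rw [this, eq_intCast]
    have h2 := (ZMod.intCast_zmod_eq_zero_iff_dvd _ _).1 h1
    exact_mod_cast h2
  · intro a ha
    rw [hval, ZMod.natCast_eq_zero_iff] at ha
    obtain ⟨b, hb⟩ := ha
    exact ⟨b, by rw [← Nat.cast_mul, ← hb, ZMod.natCast_zmod_val]⟩
  · intro a ha
    rw [hval, Ne, ZMod.natCast_eq_zero_iff, ← hp.coprime_iff_not_dvd] at ha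
    rw [← ZMod.natCast_zmod_val a, ZMod.isUnit_iff_coprime]
    exact (ha.pow_left e).symm
  · rw [← Nat.cast_pow, ← he, ZMod.natCast_self]
  · intro i
    obtain ⟨a, ha, h⟩ := hx i
    refine ⟨a, ha, fun k => ?_⟩
    rw [map_intCast, h]
  · intro i
    rw [hcast, hfx, Int.cast_zero]

theorem det_eq_zero_of_dvd_of_abs_le {ι : Type*} [Fintype ι] [DecidableEq ι] [Nonempty ι]
    (M : Matrix ι ι ℤ) (p t : ℕ) (B : ℝ) (hM : ∀ i j, |(M i j : ℝ)| ≤ B)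
    (hB : Fintype.card ι * B < (p : ℝ) ^ t) (hdvd : (p : ℤ) ^ (Fintype.card ι * t) ∣ M.det) :
    M.det = 0 := by
  have hB0 : 0 ≤ B := (abs_nonneg _).trans (hM (Classical.arbitrary ι) (Classical.arbitrary ι))
  have h1 : |((M.det : ℤ) : ℝ)| ≤ (Fintype.card ι).factorial • B ^ Fintype.card ι := by
    have := Matrix.det_le (A := M.map (Int.castRingHom ℝ)) (abv := AbsoluteValue.abs) (x := B)
      (by simpa using hM)
    rwa [← RingHom.mapMatrix_apply, ← RingHom.map_det] at this
  have h2 : ((Fintype.card ι).factorial • B ^ Fintype.card ι : ℝ) ≤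
      (Fintype.card ι * B) ^ Fintype.card ι := by
    rw [nsmul_eq_mul, mul_pow]
    gcongr
    exact_mod_cast Nat.factorial_le_pow _
  have h3 : (Fintype.card ι * B) ^ Fintype.card ι < ((p : ℝ) ^ t) ^ Fintype.card ι :=
    pow_lt_pow_left₀ hB (by positivity) Fintype.card_ne_zero
  refine Int.eq_zero_of_abs_lt_dvd hdvd ?_
  have h4 := (h1.trans h2).trans_lt h3
  rw [← pow_mul, mul_comm t] at h4
  exact_mod_cast h4

theorem exists_linear_relation_of_det_eq_zero {K ι : Type*} [Field K] [Fintype ι] [DecidableEq ι]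
    (S : Set (ι → K)) (hS : ∀ r : ι → ι → K, (∀ i, r i ∈ S) → Matrix.det (Matrix.of r) = 0) :
    ∃ c : ι → K, c ≠ 0 ∧ ∀ v ∈ S, ∑ a, c a * v a = 0 := by
  have hlt : Submodule.span K S < ⊤ := by
    rw [lt_top_iff_ne_top]
    intro htop
    obtain ⟨r, hr, -, hli⟩ := Submodule.exists_fun_fin_finrank_span_eq K S
    have hcard : Module.finrank K (Submodule.span K S) = Fintype.card ι := by
      rw [htop, finrank_top, Module.finrank_fintype_fun_eq_card]
    let E : ι ≃ Fin (Module.finrank K (Submodule.span K S)) :=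
      Fintype.equivOfCardEq (by rw [Fintype.card_fin, hcard])
    have h1 : LinearIndependent K (Matrix.of (r ∘ E)).row := hli.comp E E.injective
    rw [Matrix.linearIndependent_rows_iff_isUnit, Matrix.isUnit_iff_isUnit_det,
      hS (r ∘ E) fun i => hr (E i)] at h1
    exact not_isUnit_zero h1
  obtain ⟨φ, hφ, hle⟩ := Submodule.exists_le_ker_of_lt_top _ hlt
  have hφv : ∀ v, φ v = ∑ a, φ (Pi.single a 1) * v a := by
    intro v
    conv_lhs => rw [pi_eq_sum_univ' v, map_sum]
    simp [mul_comm]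
  refine ⟨fun a => φ (Pi.single a 1), fun h0 => hφ ?_, fun v hv => ?_⟩
  · ext v
    simp [congrFun h0]
  · rw [← hφv]
    exact hle (Submodule.subset_span hv)

theorem exists_exponent {H : ℝ} (hH : Real.exp (Real.exp 129) ≤ H) {d p m : ℕ}
    (hd : Real.log H ^ 2 < d) (hd' : (d : ℝ) < H ^ ((3 : ℝ) / 2)) (hp : Real.log H < p)
    (hm : (m : ℝ) < d / Real.log H) :
    ∃ t : ℕ, m * (2 * t + 1) ≤ ((d + 1) / 2) * ((d + 1) / 2) ∧
      (((d + 1) / 2 * ((d + 1) / 2) : ℕ) : ℝ) * H ^ (d - 1) < (p : ℝ) ^ t := by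
  have hHpos : 0 < H := (Real.exp_pos _).trans_le hH
  set l := Real.log H with hl
  have hl1 : Real.exp 129 ≤ l := (Real.le_log_iff_exp_le hHpos).2 hH
  have hl2 : 130 ≤ l := by linarith [Real.add_one_le_exp (129 : ℝ)]
  have hd1 : (130 : ℝ) ≤ d := by nlinarith
  have hppos : (0 : ℝ) < p := by linarith
  have hlp : 129 ≤ Real.log p :=
    (Real.le_log_iff_exp_le hppos).2 (by linarith)
  have hn1 : (d : ℝ) / 2 ≤ ((d + 1) / 2 : ℕ) := by
    have : d ≤ 2 * ((d + 1) / 2) := by omega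
    have : (d : ℝ) ≤ 2 * ((d + 1) / 2 : ℕ) := by exact_mod_cast this
    linarith
  have hn2 : (((d + 1) / 2 : ℕ) : ℝ) ≤ d := by
    have : 1 ≤ d := by
      have : (1 : ℝ) ≤ d := by linarith
      exact_mod_cast this
    exact_mod_cast (by omega : (d + 1) / 2 ≤ d)
  set n := (d + 1) / 2 with hn
  have hdl : 0 ≤ d * l / 16 := by positivity
  refine ⟨⌊d * l / 16⌋₊, ?_, ?_⟩
  · have ht : ((⌊d * l / 16⌋₊ : ℕ) : ℝ) ≤ d * l / 16 := Nat.floor_le hdl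
    have h1 : (m : ℝ) * (2 * (⌊d * l / 16⌋₊ : ℕ) + 1) ≤ n * n := by
      calc (m : ℝ) * (2 * (⌊d * l / 16⌋₊ : ℕ) + 1) ≤ d / l * (2 * (d * l / 16) + 1) := by
            gcongr
        _ = d * d / 8 + d / l := by field_simp; ring
        _ ≤ d * d / 8 + d := by
            gcongr
            exact div_le_self (by positivity) (by linarith)
        _ ≤ d / 2 * (d / 2) := by nlinarith
        _ ≤ n * n := by gcongr
    exact_mod_cast h1
  · rw [Nat.cast_mul]
    have ht : d * l / 16 - 1 < ((⌊d * l / 16⌋₊ : ℕ) : ℝ) := by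
      linarith [Nat.lt_floor_add_one (d * l / 16)]
    have hnpos : (0 : ℝ) < n := by linarith
    have hlogn : Real.log n ≤ 3 / 2 * l := by
      rw [hl, ← Real.log_rpow hHpos]
      exact Real.log_le_log hnpos (by linarith)
    have hd2 : ((d - 1 : ℕ) : ℝ) ≤ d := by exact_mod_cast Nat.sub_le d 1
    rw [← Real.log_lt_log_iff (mul_pos (by positivity) (by positivity)) (pow_pos hppos _),
      Real.log_pow,
      Real.log_mul (by positivity) (by positivity), Real.log_pow,
      Real.log_mul hnpos.ne' hnpos.ne']
    calc Real.log n + Real.log n + ((d - 1 : ℕ) : ℝ) * l ≤ 3 * l + d * l := by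
          have := mul_le_mul_of_nonneg_right hd2 (by linarith : 0 ≤ l)
          linarith
      _ < (d * l / 16 - 1) * 129 := by nlinarith
      _ ≤ _ := mul_le_mul ht.le hlp (by norm_num) (Nat.cast_nonneg _)

theorem map_ne_zero_of_gcd_coeff_eq_one {σ : Type*} {f : MvPolynomial σ ℤ}
    (hf : Finset.gcd f.support f.coeff = 1) (p : ℕ) [Fact p.Prime] :
    map (Int.castRingHom (ZMod p)) f ≠ 0 := by
  intro h0
  have hdvd : (p : ℤ) ∣ Finset.gcd f.support f.coeff := by
    refine Finset.dvd_gcd fun s _ => ?_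
    have := congrArg (coeff s) h0
    rwa [coeff_map, coeff_zero, eq_intCast, ZMod.intCast_zmod_eq_zero_iff_dvd] at this
  rw [hf] at hdvd
  exact (Nat.prime_iff_prime_int.1 (Fact.out : p.Prime)).not_isUnit (isUnit_of_dvd_one hdvd)

/-- The exponents `(a, b, D - a - b)`. -/
noncomputable def planeExponent (D a b : ℕ) : Fin 3 →₀ ℕ :=
  Finsupp.equivFunOnFinite.symm ![a, b, D - a - b]

theorem degree_planeExponent {D a b : ℕ} (h : a + b ≤ D) : (planeExponent D a b).degree = D := by
  rw [Finsupp.degree_eq_sum, Fin.sum_univ_three]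
  simp [planeExponent]
  omega

theorem planeExponent_inj {D a b a' b' : ℕ} (h : planeExponent D a b = planeExponent D a' b') :
    a = a' ∧ b = b' :=
  ⟨by simpa [planeExponent] using DFunLike.congr_fun h 0,
    by simpa [planeExponent] using DFunLike.congr_fun h 1⟩

theorem abs_eval_monomial_le {H : ℝ} (x : Fin 3 → ℤ) (hx : ∀ i, |(x i : ℝ)| ≤ H)
    (s : Fin 3 →₀ ℕ) : |((eval x (monomial s (1 : ℤ)) : ℤ) : ℝ)| ≤ H ^ s.degree := by
  rw [eval_monomial, one_mul, Finsupp.prod_fintype _ _ (fun _ => pow_zero _), Int.cast_prod,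
    Finset.abs_prod, Finsupp.degree_eq_sum, ← Finset.prod_pow_eq_pow_sum]
  refine Finset.prod_le_prod (fun i _ => abs_nonneg _) fun i _ => ?_
  rw [Int.cast_pow, abs_pow]
  exact pow_le_pow_left₀ (abs_nonneg _) (hx i) _

/-- There is an absolute constant `H₀` such that the following holds.  Let
`H ≥ H₀`, let `f ∈ ℤ[x₀,x₁,x₂]` be a primitive irreducible homogeneous
polynomial of degree `d` with `(log H)² < d < H^(3/2)`, defining the plane
curve `C ⊆ ℙ²_ℚ`.  Let `p > log H` be a prime, let `f̄` be the reduction of `f`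
modulo `p`, and let `P ∈ ℙ²(𝔽_p)` satisfy `mult_P(f̄) < d / log H`.  Then there
is a nonzero homogeneous polynomial `g ∈ ℚ[x₀,x₁,x₂]` of degree `d − 1`
vanishing at every point of `C(ℚ,H)` whose reduction modulo `p` is `P`.
Points of `C(ℚ,H)` are represented by primitive integer homogeneous coordinate
tuples of height at most `H`. -/
theorem statement17 :
    ∃ H₀ : ℝ, ∀ H : ℝ, H₀ ≤ H →
      ∀ (d : ℕ) (f : MvPolynomial (Fin 3) ℤ),
        Finset.gcd f.support f.coeff = 1 → Irreducible f → f.IsHomogeneous d →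
        Real.log H ^ 2 < (d : ℝ) → (d : ℝ) < H ^ ((3 : ℝ) / 2) →
      ∀ (p : ℕ) [Fact p.Prime], Real.log H < (p : ℝ) →
      ∀ P : Projectivization (ZMod p) (Fin 3 → ZMod p),
        (multAt P.rep (MvPolynomial.map (Int.castRingHom (ZMod p)) f) : ℝ)
          < (d : ℝ) / Real.log H →
      ∃ g : MvPolynomial (Fin 3) ℚ, g ≠ 0 ∧ g.IsHomogeneous (d - 1) ∧
        ∀ x : Fin 3 → ℤ,
          Finset.univ.gcd x = 1 →
          (∀ i, |(x i : ℝ)| ≤ H) →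
          eval x f = 0 →
          (∃ hx : (fun i => ((x i : ZMod p))) ≠ 0,
            Projectivization.mk (ZMod p) (fun i => ((x i : ZMod p))) hx = P) →
          eval (fun i => ((x i : ℚ))) g = 0 := by
  refine ⟨Real.exp (Real.exp 129), fun H hH d f hgcd _ hf hd hd' p _ hp P hP => ?_⟩
  obtain ⟨t, ht, htB⟩ := exists_exponent hH hd hd' hp hP
  set n := (d + 1) / 2 with hn
  have hdpos : 0 < d := by
    have : (0 : ℝ) < d := (sq_nonneg _).trans_lt hd
    exact_mod_cast this
  have : Nonempty (Fin n × Fin n) := by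
    have : NeZero n := ⟨by omega⟩
    exact ⟨(0, 0)⟩
  have hcard : Fintype.card (Fin n × Fin n) = n * n := by simp
  let s : Fin n × Fin n → Fin 3 →₀ ℕ := fun a => planeExponent (d - 1) a.1 a.2
  have hs : ∀ a, (s a).degree = d - 1 := fun a => degree_planeExponent (by omega)
  have hsinj : Function.Injective s := fun a b hab => by
    obtain ⟨h1, h2⟩ := planeExponent_inj hab
    exact Prod.ext (Fin.ext h1) (Fin.ext h2)
  let S : Set (Fin 3 → ℤ) := {x | (∀ i, |(x i : ℝ)| ≤ H) ∧ eval x f = 0 ∧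
    ∃ hx : (fun i => ((x i : ZMod p))) ≠ 0,
      Projectivization.mk (ZMod p) (fun i => ((x i : ZMod p))) hx = P}
  have hdet : ∀ x : Fin n × Fin n → Fin 3 → ℤ, (∀ i, x i ∈ S) →
      Matrix.det (Matrix.of fun a i => eval (x i) (monomial (s a) (1 : ℤ))) = 0 := by
    intro x hx
    refine det_eq_zero_of_dvd_of_abs_le _ p t (H ^ (d - 1)) (fun a i => ?_) (by rwa [hcard])
      (pow_dvd_det_eval_monomial p t hf (map_ne_zero_of_gcd_coeff_eq_one hgcd p) P.rep
        P.rep_nonzero (by rwa [hcard]) x (fun i => ?_) (fun i => (hx i).2.1) (d - 1) s hs)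
    · rw [← hs a]
      exact abs_eval_monomial_le _ (hx i).1 _
    · obtain ⟨hx0, hxP⟩ := (hx i).2.2
      rw [← P.mk_rep, Projectivization.mk_eq_mk_iff] at hxP
      obtain ⟨a, ha⟩ := hxP
      exact ⟨a, a.ne_zero, fun k => (congrFun ha k).symm⟩
  obtain ⟨c, hc, hcS⟩ := exists_linear_relation_of_det_eq_zero (K := ℚ)
    ((fun x a => ((eval x (monomial (s a) (1 : ℤ)) : ℤ) : ℚ)) '' S) fun r hr => by
      choose x hx hxr using hr
      rw [← Matrix.det_transpose]
      have h1 := congrArg (Int.castRingHom ℚ) (hdet x hx)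
      rw [RingHom.map_det, map_zero] at h1
      rw [← h1]
      congr 1
      ext a i
      simp [← hxr]
  have hcoeff : ∀ a, coeff (s a) (∑ b, monomial (s b) (c b)) = c a := by
    intro a
    rw [coeff_sum, Finset.sum_eq_single a]
    · simp
    · intro b _ hb
      rw [coeff_monomial, if_neg fun h => hb (hsinj h)]
    · simp
  refine ⟨∑ a, monomial (s a) (c a), fun h0 => hc ?_, ?_, fun x _ hxH hxf hxP => ?_⟩
  · funext a
    rw [← hcoeff a, h0, coeff_zero, Pi.zero_apply]
  · exact IsHomogeneous.sum _ _ _ fun a _ => isHomogeneous_monomial _ (hs a)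
  · have h1 := hcS _ ⟨x, ⟨hxH, hxf, hxP⟩, rfl⟩
    rw [map_sum, ← h1]
    refine Finset.sum_congr rfl fun a _ => ?_
    simp [eval_monomial, Finsupp.prod]
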